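/- Let A and B be nonzero integers with A² + 4B > 0, and let v be the Lucas sequence of the second kind corresponding to (A,B). Assume that none of the following holds: (B < 0 and |A| ≤ 7), (|A| = 1 and 0 < B ≤ 14), (|A| = 2 and 0 < B ≤ 3). Then for all nonnegative integers n > n' such that n is even or n ≥ 7, one has |v_n| > 3·|v_{n'}|. -/

import Mathlib

/-- Lucas sequence of the second kind for parameters `A`, `B`:
`v 0 = 2`, `v 1 = A`, `v (n+2) = A * v (n+1) + B * v n`. -/
def lucasV (A B : ℤ) : ℕ → ℤ
  | 0 => 2
  | 1 => A
  | n + 2 => A * lucasV A B (n + 1) + B * lucasV A B n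

theorem lucasV_succ_succ (A B : ℤ) (n : ℕ) :
    lucasV A B (n + 2) = A * lucasV A B (n + 1) + B * lucasV A B n := rfl

theorem lucasV_neg (A B : ℤ) (n : ℕ) :
    lucasV (-A) B n = (-1) ^ n * lucasV A B n ∧
      lucasV (-A) B (n + 1) = (-1) ^ (n + 1) * lucasV A B (n + 1) := by
  induction n with
  | zero => simp [lucasV]
  | succ n ih =>
    refine ⟨ih.2, ?_⟩
    rw [lucasV_succ_succ, lucasV_succ_succ, ih.1, ih.2]
    ring

theorem abs_lucasV_neg (A B : ℤ) (n : ℕ) : |lucasV (-A) B n| = |lucasV A B n| := by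
  rw [(lucasV_neg A B n).1, abs_mul, abs_neg_one_pow, one_mul]

theorem abs_lucasV_abs (A B : ℤ) (n : ℕ) : |lucasV |A| B n| = |lucasV A B n| := by
  rcases abs_choice A with h | h <;> rw [h]
  exact abs_lucasV_neg A B n

theorem lucasV_pos_and_mul_le (A B : ℤ) (hA : 0 < A) (hdom : 0 < A ^ 2 + 4 * B) (n : ℕ) :
    0 < lucasV A B n ∧ A * lucasV A B n ≤ 2 * lucasV A B (n + 1) := by
  induction n with
  | zero => simp [lucasV]; linarith
  | succ n ih =>
    obtain ⟨h1, h2⟩ := ih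
    have h3 : 0 < lucasV A B (n + 1) := by nlinarith [mul_pos hA h1]
    refine ⟨h3, ?_⟩
    rw [lucasV_succ_succ]
    nlinarith [mul_le_mul_of_nonneg_left h2 hA.le, mul_pos hdom h1]

theorem three_mul_lucasV_lt_of_eight_le (A B : ℤ) (hA : 8 ≤ A) (hdom : 0 < A ^ 2 + 4 * B)
    {m n : ℕ} (hmn : m < n) : 3 * lucasV A B m < lucasV A B n := by
  have key := fun k => lucasV_pos_and_mul_le A B (by linarith) hdom k
  have step : ∀ k, 3 * lucasV A B k < lucasV A B (k + 1) := fun k => by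
    nlinarith [(key k).1, (key k).2]
  have mono : Monotone (lucasV A B) :=
    monotone_nat_of_le_succ fun k => by linarith [step k, (key k).1]
  exact (step m).trans_le (mono hmn)

theorem lucasV_pos (A B : ℤ) (hA : 0 < A) (hB : 0 < B) (n : ℕ) :
    0 < lucasV A B n ∧ 0 < lucasV A B (n + 1) := by
  induction n with
  | zero => simp [lucasV, hA]
  | succ n ih =>
    refine ⟨ih.2, ?_⟩
    rw [lucasV_succ_succ]
    nlinarith [mul_pos hA ih.2, mul_pos hB ih.1]

theorem lucasV_le_of_pos (A B : ℤ) (hA : 0 < A) (hB : 0 < B) {m n : ℕ} (hm : 1 ≤ m)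
    (hmn : m ≤ n) : lucasV A B m ≤ lucasV A B n := by
  induction n, hmn using Nat.le_induction with
  | base => rfl
  | succ n hn ih =>
    obtain ⟨k, rfl⟩ : ∃ k, n = k + 1 := ⟨n - 1, by omega⟩
    refine ih.trans ?_
    rw [lucasV_succ_succ]
    have := lucasV_pos A B hA hB k
    nlinarith [mul_pos hB this.1]

theorem three_mul_lucasV_lt_succ_of_consecutive (A B : ℤ) (hA : 0 < A) (hB : 0 < B) (k : ℕ)
    (h0 : 3 * lucasV A B k < lucasV A B (k + 1))
    (h1 : 3 * lucasV A B (k + 1) < lucasV A B (k + 2)) (n : ℕ) :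
    3 * lucasV A B (k + n) < lucasV A B (k + n + 1) ∧
      3 * lucasV A B (k + n + 1) < lucasV A B (k + n + 2) := by
  induction n with
  | zero => exact ⟨h0, h1⟩
  | succ n ih =>
    refine ⟨ih.2, ?_⟩
    rw [← add_assoc, lucasV_succ_succ A B (k + n + 1), lucasV_succ_succ A B (k + n)]
    rw [lucasV_succ_succ A B (k + n)] at ih
    nlinarith [mul_lt_mul_of_pos_left ih.1 hB, mul_lt_mul_of_pos_left ih.2 hA]

theorem three_mul_lucasV_lt_succ (A B : ℤ) (hA : 0 < A) (hB : 0 < B) (h1 : A = 1 → 15 ≤ B)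
    (h2 : A = 2 → 4 ≤ B) (n : ℕ) (hn1 : 1 ≤ n) (hn : Even (n + 1) ∨ 7 ≤ n + 1) :
    3 * lucasV A B n < lucasV A B (n + 1) := by
  obtain hA3 | hA3 := le_or_gt 3 A
  · obtain ⟨m, rfl⟩ := Nat.exists_eq_add_of_le hn1
    refine (three_mul_lucasV_lt_succ_of_consecutive A B hA hB 1 ?_ ?_ m).1
    · simp only [lucasV]
      nlinarith
    · simp only [lucasV]
      nlinarith [mul_nonneg (sq_nonneg A) (sub_nonneg.2 hA3), mul_nonneg hB.le (sub_nonneg.2 hA3)]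
  have key : 3 * lucasV A B 1 < lucasV A B 2 ∧ 3 * lucasV A B 3 < lucasV A B 4 ∧
      3 * lucasV A B 5 < lucasV A B 6 ∧ 3 * lucasV A B 6 < lucasV A B 7 := by
    obtain rfl | rfl : A = 1 ∨ A = 2 := by omega
    · obtain ⟨c, hc, rfl⟩ : ∃ c : ℤ, 0 ≤ c ∧ B = c + 15 := ⟨B - 15, by linarith [h1 rfl], by ring⟩
      simp only [lucasV]
      refine ⟨?_, ?_, ?_, ?_⟩ <;> rw [← sub_pos] <;> ring_nf <;> positivity
    · obtain ⟨c, hc, rfl⟩ : ∃ c : ℤ, 0 ≤ c ∧ B = c + 4 := ⟨B - 4, by linarith [h2 rfl], by ring⟩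
      simp only [lucasV]
      refine ⟨?_, ?_, ?_, ?_⟩ <;> rw [← sub_pos] <;> ring_nf <;> positivity
  obtain ⟨k1, k3, k5, k6⟩ := key
  obtain h5 | h5 := le_or_gt 5 n
  · obtain ⟨m, rfl⟩ := Nat.exists_eq_add_of_le h5
    exact (three_mul_lucasV_lt_succ_of_consecutive A B hA hB 5 k5 k6 m).1
  · obtain rfl | rfl : n = 1 ∨ n = 3 := by
      obtain ⟨r, hr⟩ | h := hn <;> omega
    · exact k1
    · exact k3

theorem three_mul_lucasV_lt_of_pos (A B : ℤ) (hA : 0 < A) (hB : 0 < B) (h1 : A = 1 → 15 ≤ B)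
    (h2 : A = 2 → 4 ≤ B) {m n : ℕ} (hmn : m < n) (hn : Even n ∨ 7 ≤ n) :
    3 * lucasV A B m < lucasV A B n := by
  obtain ⟨k, rfl⟩ : ∃ k, n = k + 1 := ⟨n - 1, by omega⟩
  have hk : 1 ≤ k := by
    obtain ⟨r, hr⟩ | h := hn <;> omega
  obtain rfl | hm := Nat.eq_zero_or_pos m
  · refine lt_of_lt_of_le ?_ (lucasV_le_of_pos A B hA hB (m := 2) (by omega) (by omega))
    simp only [lucasV]
    obtain h | h | h : A = 1 ∨ A = 2 ∨ 3 ≤ A := by omega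
    · subst h; linarith [h1 rfl]
    · subst h; linarith [h2 rfl]
    · nlinarith
  · have := lucasV_le_of_pos A B hA hB hm (Nat.le_of_lt_succ hmn)
    linarith [three_mul_lucasV_lt_succ A B hA hB h1 h2 k hk hn]

theorem stmt_14 (A B : ℤ) (hA : A ≠ 0) (hB : B ≠ 0) (hdom : A ^ 2 + 4 * B > 0)
    (h1 : ¬ (B < 0 ∧ |A| ≤ 7)) (h2 : ¬ (|A| = 1 ∧ 0 < B ∧ B ≤ 14))
    (h3 : ¬ (|A| = 2 ∧ 0 < B ∧ B ≤ 3)) :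
    ∀ n n' : ℕ, n' < n → (Even n ∨ 7 ≤ n) →
      |lucasV A B n| > 3 * |lucasV A B n'| := by
  intro n m hmn hn
  rw [← abs_lucasV_abs A B n, ← abs_lucasV_abs A B m]
  have hA' : 0 < |A| := abs_pos.2 hA
  rw [← sq_abs] at hdom
  generalize |A| = a at *
  obtain hneg | hpos := lt_or_gt_of_ne hB
  · rw [abs_of_pos (lucasV_pos_and_mul_le a B hA' hdom n).1,
      abs_of_pos (lucasV_pos_and_mul_le a B hA' hdom m).1]
    exact three_mul_lucasV_lt_of_eight_le a B (by omega) hdom hmn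
  · rw [abs_of_pos (lucasV_pos a B hA' hpos n).1, abs_of_pos (lucasV_pos a B hA' hpos m).1]
    exact three_mul_lucasV_lt_of_pos a B hA' hpos (by omega) (by omega) hmn hn
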